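/- For every weak solution (Ω, F, 𝔽, P, B, X, α) of X_t = ∫_0^t α_s ds + B_t in which the control α is progressively measurable with respect to the P-augmented natural filtration of B (open-loop), one has P((B, X) ∈ D) = 0; consequently the open-loop value satisfies V^o_0 = 0. -/

import Mathlib

open MeasureTheory ProbabilityTheory Filter Set Matrix
open scoped Classical

noncomputable section

/-- The σ-algebra generated by the `P`-null sets. -/
def nullSets {Ω : Type*} [MeasurableSpace Ω] (P : Measure Ω) : MeasurableSpace Ω :=
  MeasurableSpace.generateFrom {s : Set Ω | P s = 0}

/-- The natural filtration of a process `u`. -/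
def natFilt {Ω E : Type*} [MeasurableSpace E] (u : ℝ → Ω → E) (s : ℝ) :
    MeasurableSpace Ω :=
  ⨆ r ∈ Set.Icc (0 : ℝ) s, MeasurableSpace.comap (u r) inferInstance

/-- The `P`-augmented natural filtration of a process `u`. -/
def augFilt {Ω E : Type*} [MeasurableSpace Ω] [MeasurableSpace E] (P : Measure Ω)
    (u : ℝ → Ω → E) (s : ℝ) : MeasurableSpace Ω :=
  natFilt u s ⊔ nullSets P

/-- Progressive measurability of a process `u` with respect to a family of σ-algebras `F`. -/
def ProgMeas {Ω E : Type*} [MeasurableSpace E] (F : ℝ → MeasurableSpace Ω)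
    (u : ℝ → Ω → E) : Prop :=
  ∀ s : ℝ, 0 ≤ s →
    @Measurable (Set.Icc (0 : ℝ) s × Ω) E
      (MeasurableSpace.prod inferInstance (F s)) _ (fun p => u p.1 p.2)

/-- Tsirelson's drift, relative to the time sequence `t : ℤ → ℝ`:
`μ(s, x) = fract ((x (t k) - x (t (k-1))) / (t k - t (k-1)))` for `s ∈ [t k, t (k+1))`,
`k ≤ -1`, and `0` otherwise. -/
def tsirelsonDrift (t : ℤ → ℝ) (s : ℝ) (x : ℝ → ℝ) : ℝ :=
  if h : ∃ k : ℤ, k ≤ -1 ∧ t k ≤ s ∧ s < t (k + 1) then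
    Int.fract ((x (t h.choose) - x (t (h.choose - 1))) / (t h.choose - t (h.choose - 1)))
  else 0

/-- The hypotheses on the time sequence: `t 0 = T`, strictly increasing, and
`t k ↓ 0` as `k → -∞`. -/
def TsirelsonTimes (T : ℝ) (t : ℤ → ℝ) : Prop :=
  t 0 = T ∧ (∀ k : ℤ, k ≤ 0 → t (k - 1) < t k) ∧
    Tendsto (fun n : ℕ => t (-(n : ℤ))) atTop (nhds 0)

/-- `B` is a one-dimensional `F`-Brownian motion under `P`: continuous paths started at `0`,
adapted, with increments that are centered Gaussian and independent of the past. -/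
def IsBM {Ω : Type*} [MeasurableSpace Ω] (P : Measure Ω) (F : ℝ → MeasurableSpace Ω)
    (B : ℝ → Ω → ℝ) : Prop :=
  (∀ ω, B 0 ω = 0) ∧ (∀ ω, Continuous fun s => B s ω) ∧
  (∀ s : ℝ, 0 ≤ s → Measurable[F s] (B s)) ∧
  (∀ s u : ℝ, 0 ≤ s → s < u →
    Measure.map (fun ω => B u ω - B s ω) P = gaussianReal 0 ((u - s).toNNReal) ∧
    Indep (MeasurableSpace.comap (fun ω => B u ω - B s ω) inferInstance) (F s) P)

/-- The process `α*` from the counterexample: a clamped pathwise left derivative of the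
difference of the two coordinate paths,
`α*(s, (w, x)) = 0 ∨ [limsup_{h→0} ((x-w)_s - (x-w)_{(s-h)⁺})/h] ∧ 1`. -/
def alphaStar (s : ℝ) (w x : ℝ → ℝ) : ℝ :=
  max 0 (min 1 (Filter.limsup
    (fun h : ℝ => ((x s - w s) - (x (max (s - h) 0) - w (max (s - h) 0))) / h)
    (nhdsWithin 0 (Set.Ioi 0))))

/-- The set `D` of pairs of paths `(w, x)` with `∫_0^T |α*(s,(w,x)) - μ(s,x)| ds = 0`. -/
def tsirelsonSetD (T : ℝ) (t : ℤ → ℝ) : Set ((ℝ → ℝ) × (ℝ → ℝ)) :=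
  {p | (∫ s in Set.Icc (0 : ℝ) T, |alphaStar s p.1 p.2 - tsirelsonDrift t s p.2|) = 0}

/-- A weak solution of the controlled SDE `X_s = ∫_0^s α_r dr + B_s` on `[0, T]`,
with control valued in `A = [0, 1]`. -/
structure ControlWeakSol (T : ℝ) where
  Ω : Type
  mΩ : MeasurableSpace Ω
  P : @Measure Ω mΩ
  hP : IsProbabilityMeasure P
  F : ℝ → MeasurableSpace Ω
  F_mono : ∀ s u : ℝ, s ≤ u → F s ≤ F u
  F_le : ∀ s : ℝ, F s ≤ mΩ
  B : ℝ → Ω → ℝ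
  X : ℝ → Ω → ℝ
  α : ℝ → Ω → ℝ
  hB : @IsBM Ω mΩ P F B
  α_prog : ProgMeas F α
  α_mem : ∀ s ω, α s ω ∈ Set.Icc (0 : ℝ) 1
  X_cont : ∀ ω, Continuous fun s => X s ω
  X_prog : ProgMeas F X
  sde : ∀ᵐ ω ∂P, ∀ s ∈ Set.Icc (0 : ℝ) T,
    X s ω = (∫ r in Set.Icc (0 : ℝ) s, α r ω) + B s ω

attribute [instance] ControlWeakSol.mΩ

/-- Open-loop: the control is prog. measurable w.r.t. the `P`-augmented natural filtration
of `B`. -/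
def ControlWeakSol.OpenLoop {T : ℝ} (S : ControlWeakSol T) : Prop :=
  ProgMeas (augFilt S.P S.B) S.α

/-- Closed-loop: the control is prog. measurable w.r.t. the `P`-augmented natural filtration
of `X`. -/
def ControlWeakSol.ClosedLoop {T : ℝ} (S : ControlWeakSol T) : Prop :=
  ProgMeas (augFilt S.P S.X) S.α

/-- The payoff `E^P[1_D(B, X)] = P((B, X) ∈ D)`. -/
def ControlWeakSol.payoff {T : ℝ} (t : ℤ → ℝ) (S : ControlWeakSol T) : ℝ :=
  (S.P {ω | ((fun s => S.B s ω), (fun s => S.X s ω)) ∈ tsirelsonSetD T t}).toReal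

/-- The open-loop value `V^o_0`. -/
def VopenD (T : ℝ) (t : ℤ → ℝ) : ℝ :=
  sSup {r | ∃ S : ControlWeakSol T, S.OpenLoop ∧ r = S.payoff t}

/-- The closed-loop value `V^c_0`. -/
def VclosedD (T : ℝ) (t : ℤ → ℝ) : ℝ :=
  sSup {r | ∃ S : ControlWeakSol T, S.ClosedLoop ∧ r = S.payoff t}

/-- The σ-algebra generated by the increments of `B` after time `s`. -/
def futureFilt {Ω : Type*} (B : ℝ → Ω → ℝ) (s : ℝ) : MeasurableSpace Ω :=
  ⨆ u : Ici s, MeasurableSpace.comap (fun ω => B u ω - B s ω) inferInstance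

theorem measurable_sub_futureFilt {Ω : Type*} {B : ℝ → Ω → ℝ} {s u v : ℝ}
    (hu : s ≤ u) (hv : s ≤ v) :
    Measurable[futureFilt B s] fun ω => B u ω - B v ω := by
  have key : ∀ w, s ≤ w → Measurable[futureFilt B s] fun ω => B w ω - B s ω := fun w hw =>
    (comap_measurable _).mono
      (le_iSup (fun u : Ici s => MeasurableSpace.comap (fun ω => B u ω - B s ω) inferInstance)
        ⟨w, hw⟩) le_rfl
  have := (key u hu).sub (key v hv)
  simpa [Pi.sub_def] using this

theorem futureFilt_antitone {Ω : Type*} {B : ℝ → Ω → ℝ} : Antitone (futureFilt B) := fun _ _ hsv =>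
  iSup_le fun u =>
    (measurable_sub_futureFilt (hsv.trans u.2) hsv).comap_le

section Independence

variable {Ω : Type*} [mΩ : MeasurableSpace Ω] {P : Measure Ω}

theorem indep_sup_of_indep_sup [IsProbabilityMeasure P] {m₁ m₂ m₃ : MeasurableSpace Ω}
    (h₁ : m₁ ≤ mΩ) (h₂ : m₂ ≤ mΩ) (h₃ : m₃ ≤ mΩ) (h₁₃ : Indep m₁ m₃ P) (h : Indep m₂ (m₁ ⊔ m₃) P) :
    Indep (m₁ ⊔ m₂) m₃ P := by
  set p : Set (Set Ω) := image2 (· ∩ ·) {s | MeasurableSet[m₁] s} {s | MeasurableSet[m₂] s}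
    with hp
  have hpi : IsPiSystem p := by
    rintro _ ⟨a, ha, b, hb, rfl⟩ _ ⟨c, hc, d, hd, rfl⟩ -
    exact ⟨a ∩ c, MeasurableSet.inter ha hc, b ∩ d, MeasurableSet.inter hb hd,
      inter_inter_inter_comm _ _ _ _⟩
  have hle : m₁ ⊔ m₂ ≤ MeasurableSpace.generateFrom p := by
    refine sup_le (fun s hs => ?_) fun s hs => ?_
    · exact .basic _ ⟨s, hs, univ, MeasurableSet.univ, inter_univ s⟩
    · exact .basic _ ⟨univ, MeasurableSet.univ, s, hs, univ_inter s⟩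
  refine indep_of_indep_of_le_left ?_ hle
  rw [← @MeasurableSpace.generateFrom_measurableSet Ω m₃]
  refine IndepSets.indep' ?_ (fun s hs => h₃ s hs) hpi
    (@MeasurableSpace.isPiSystem_measurableSet Ω m₃) ?_
  · rintro _ ⟨a, ha, b, hb, rfl⟩
    exact (h₁ _ ha).inter (h₂ _ hb)
  rw [IndepSets_iff]
  rintro _ u ⟨a, ha, b, hb, rfl⟩ hu
  rw [Indep_iff] at h h₁₃
  have e₁ := h b (a ∩ u) hb (MeasurableSet.inter ((le_sup_left : m₁ ≤ m₁ ⊔ m₃) _ ha)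
    ((le_sup_right : m₃ ≤ m₁ ⊔ m₃) _ hu))
  have e₂ := h b a hb ((le_sup_left : m₁ ≤ m₁ ⊔ m₃) _ ha)
  have e₃ := h₁₃ a u ha hu
  change P (a ∩ b ∩ u) = P (a ∩ b) * P u
  rw [inter_comm a b, inter_assoc, e₁, e₂, e₃, mul_assoc]

theorem integral_mul_of_indep {m₁ m₂ : MeasurableSpace Ω} (h₁ : m₁ ≤ mΩ) (h₂ : m₂ ≤ mΩ)
    (h : Indep m₁ m₂ P) {f g : Ω → ℂ} (hf : Measurable[m₁] f) (hg : Measurable[m₂] g) :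
    ∫ ω, f ω * g ω ∂P = (∫ ω, f ω ∂P) * ∫ ω, g ω ∂P := by
  refine IndepFun.integral_fun_mul_eq_mul_integral ?_
    (hf.mono h₁ le_rfl).aestronglyMeasurable (hg.mono h₂ le_rfl).aestronglyMeasurable
  rw [IndepFun_iff_Indep]
  exact indep_of_indep_of_le_left (indep_of_indep_of_le_right h hg.comap_le) hf.comap_le

variable {F : ℝ → MeasurableSpace Ω} {B : ℝ → Ω → ℝ}

theorem IsBM.measurable (hB : IsBM P F B) (hle : ∀ s, F s ≤ mΩ) {s : ℝ} (hs : 0 ≤ s) :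
    Measurable (B s) := (hB.2.2.1 s hs).mono (hle s) le_rfl

theorem IsBM.futureFilt_le (hB : IsBM P F B) (hle : ∀ s, F s ≤ mΩ) {s : ℝ} (hs : 0 ≤ s) :
    futureFilt B s ≤ mΩ :=
  iSup_le fun u => ((hB.measurable hle (hs.trans u.2)).sub (hB.measurable hle hs)).comap_le

theorem IsBM.indep_finset [IsProbabilityMeasure P] (hB : IsBM P F B)
    (hmono : Monotone F) (hle : ∀ s, F s ≤ mΩ) {s : ℝ}
    (hs : 0 ≤ s) (S : Finset ℝ) (hS : ∀ u ∈ S, s < u) :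
    Indep (⨆ u ∈ S, MeasurableSpace.comap (fun ω => B u ω - B s ω) inferInstance) (F s) P := by
  induction S using Finset.induction_on_max with
  | empty => simpa using indep_bot_left (F s)
  | insert u S hu ih =>
    have hS' : ∀ v ∈ S, s < v := fun v hv => hS v (Finset.mem_insert_of_mem hv)
    have hsu : s < u := hS u (Finset.mem_insert_self _ _)
    have hinc : ∀ v, 0 ≤ v → Measurable fun ω => B u ω - B v ω := fun v h0v =>
      (hB.measurable hle (hs.trans hsu.le)).sub (hB.measurable hle h0v)
    set m := ⨆ v ∈ S, MeasurableSpace.comap (fun ω => B v ω - B s ω) inferInstance with hm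
    obtain ⟨v, hsv, hvu, hSv, hv⟩ : ∃ v, s ≤ v ∧ v < u ∧ (∀ x ∈ S, x ≤ v) ∧
        Measurable[m] fun ω => B v ω - B s ω := by
      rcases S.eq_empty_or_nonempty with rfl | hne
      · refine ⟨s, le_rfl, hsu, by simp, ?_⟩
        simp only [sub_self]
        exact measurable_const
      · have hmem := S.max'_mem hne
        exact ⟨S.max' hne, (hS' _ hmem).le, hu _ hmem, fun x hx => S.le_max' x hx,
          (comap_measurable _).mono (le_iSup₂ (f := fun v (_ : v ∈ S) =>
            MeasurableSpace.comap (fun ω => B v ω - B s ω) inferInstance) _ hmem) le_rfl⟩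
    have hmF : m ≤ F v := by
      refine iSup₂_le fun x hx => Measurable.comap_le ?_
      exact ((hB.2.2.1 x (hs.trans (hS' x hx).le)).mono (hmono (hSv x hx)) le_rfl).sub
        ((hB.2.2.1 s hs).mono (hmono hsv) le_rfl)
    have h0v := hs.trans hsv
    have hind := indep_sup_of_indep_sup (mΩ := mΩ) (hmF.trans (hle v)) (hinc v h0v).comap_le (hle s)
      (ih hS') (indep_of_indep_of_le_right (hB.2.2.2 v u h0v hvu).2 (sup_le hmF (hmono hsv)))
    refine indep_of_indep_of_le_left hind (iSup₂_le fun x hx => ?_)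
    rcases Finset.mem_insert.1 hx with rfl | hx
    · refine Measurable.comap_le ?_
      set m' := m ⊔ MeasurableSpace.comap (fun ω => B x ω - B v ω) inferInstance
      have := ((comap_measurable (fun ω => B x ω - B v ω)).mono
        (le_sup_right : _ ≤ m') le_rfl).add (hv.mono (le_sup_left : m ≤ m') le_rfl)
      simpa [Pi.add_def] using this
    · exact le_sup_of_le_left (le_iSup₂ (f := fun v (_ : v ∈ S) =>
        MeasurableSpace.comap (fun ω => B v ω - B s ω) inferInstance) x hx)

theorem IsBM.indep_futureFilt [IsProbabilityMeasure P] (hB : IsBM P F B)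
    (hmono : Monotone F) (hle : ∀ s, F s ≤ mΩ)
    {s : ℝ} (hs : 0 ≤ s) : Indep (futureFilt B s) (F s) P := by
  have key : Indep (⨆ S : Finset (Ioi s), ⨆ u ∈ S.map (Function.Embedding.subtype _),
      MeasurableSpace.comap (fun ω => B u ω - B s ω) inferInstance) (F s) P := by
    refine indep_iSup_of_directed_le (fun S => hB.indep_finset hmono hle hs _ ?_) ?_ (hle s) ?_
    · intro u hu
      obtain ⟨x, -, rfl⟩ := Finset.mem_map.1 hu
      exact x.2
    · intro S
      refine iSup₂_le fun u hu => Measurable.comap_le ?_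
      obtain ⟨x, -, rfl⟩ := Finset.mem_map.1 hu
      exact (hB.measurable hle (hs.trans (le_of_lt x.2))).sub (hB.measurable hle hs)
    · refine Monotone.directed_le fun S S' hSS' => ?_
      exact biSup_mono fun u hu => Finset.map_subset_map.2 hSS' hu
  refine indep_of_indep_of_le_left key (iSup_le fun u => ?_)
  rcases eq_or_lt_of_le (mem_Ici.1 u.2) with h | h
  · rw [← h]
    refine Measurable.comap_le ?_
    simp only [sub_self]
    exact measurable_const
  · refine le_iSup_of_le {⟨u, h⟩} ?_
    simp

end Independence
section Characters

/-- The character `x ↦ exp (2πix)`. -/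
def unitExp (x : ℝ) : ℂ := Complex.exp ((2 * Real.pi * x : ℝ) * Complex.I)

theorem norm_unitExp (x : ℝ) : ‖unitExp x‖ = 1 := Complex.norm_exp_ofReal_mul_I _

theorem measurable_unitExp : Measurable unitExp := by
  unfold unitExp
  fun_prop

theorem unitExp_add (x y : ℝ) : unitExp (x + y) = unitExp x * unitExp y := by
  rw [unitExp, unitExp, unitExp, ← Complex.exp_add]
  push_cast
  ring_nf

theorem unitExp_fract (x : ℝ) : unitExp (Int.fract x) = unitExp x := by
  have h : unitExp ((⌊x⌋ : ℤ) : ℝ) = 1 := by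
    rw [unitExp, Complex.exp_eq_one_iff]
    exact ⟨⌊x⌋, by push_cast; ring⟩
  conv_rhs => rw [← Int.fract_add_floor x, unitExp_add, h, mul_one]

variable {Ω : Type*} {B : ℝ → Ω → ℝ}

/-- The increment of `B` from `s` to `u`, divided by `u - s`. -/
def incrementRatio (B : ℝ → Ω → ℝ) (s u : ℝ) (ω : Ω) : ℝ := (B u ω - B s ω) / (u - s)

theorem IsBM.norm_integral_unitExp [mΩ : MeasurableSpace Ω] {P : Measure Ω}
    {F : ℝ → MeasurableSpace Ω} (hB : IsBM P F B) (hle : ∀ s, F s ≤ mΩ) {s u : ℝ}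
    (hs : 0 ≤ s) (hsu : s < u) :
    ‖∫ ω, unitExp (incrementRatio B s u ω) ∂P‖ = Real.exp (-(2 * Real.pi ^ 2) / (u - s)) := by
  have hpos : 0 < u - s := sub_pos.2 hsu
  have hm : Measurable fun ω => B u ω - B s ω :=
    (hB.measurable hle (hs.trans hsu.le)).sub (hB.measurable hle hs)
  have h₁ : ∫ ω, unitExp (incrementRatio B s u ω) ∂P =
      charFun (gaussianReal 0 (u - s).toNNReal) (2 * Real.pi / (u - s)) := by
    rw [← (hB.2.2.2 s u hs hsu).1, charFun_apply_real, integral_map hm.aemeasurable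
      (by fun_prop)]
    refine integral_congr_ae (.of_forall fun ω => ?_)
    simp only [unitExp, incrementRatio]
    congr 1
    push_cast
    ring
  rw [h₁, charFun_gaussianReal, Complex.norm_exp]
  congr 1
  rw [Real.coe_toNNReal _ hpos.le]
  have : ((2 * Real.pi / (u - s) : ℝ) : ℂ) * ((0 : ℝ) : ℂ) * Complex.I -
      ((u - s : ℝ) : ℂ) * ((2 * Real.pi / (u - s) : ℝ) : ℂ) ^ 2 / 2 =
      ((-(2 * Real.pi ^ 2) / (u - s) : ℝ) : ℂ) := by
    rw [Complex.ofReal_zero, mul_zero, zero_mul, zero_sub]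
    norm_cast
    field_simp
  rw [this, Complex.ofReal_re]

/-- The product of `unitExp` of the normalised increments over the first `n` intervals of `τ`. -/
def charProd (B : ℝ → Ω → ℝ) (τ : ℕ → ℝ) (n : ℕ) (ω : Ω) : ℂ :=
  ∏ j ∈ Finset.range n, unitExp (incrementRatio B (τ (j + 1)) (τ j) ω)

theorem norm_charProd (τ : ℕ → ℝ) (n : ℕ) (ω : Ω) : ‖charProd B τ n ω‖ = 1 := by
  simp [charProd, norm_prod, norm_unitExp]

theorem measurable_charProd {τ : ℕ → ℝ} (hτ : Antitone τ) (n : ℕ) :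
    Measurable[futureFilt B (τ n)] (charProd B τ n) := by
  unfold charProd
  refine Finset.measurable_fun_prod _ fun j hj => measurable_unitExp.comp ?_
  have hj : j + 1 ≤ n := Finset.mem_range.1 hj
  exact (measurable_sub_futureFilt (hτ (by omega)) (hτ hj)).div_const _

end Characters

section WeakLimit

variable {Ω : Type*} [mΩ : MeasurableSpace Ω] {P : Measure Ω}
  {F : ℝ → MeasurableSpace Ω} {B : ℝ → Ω → ℝ} {τ : ℕ → ℝ} {U : ℕ → Ω → ℂ}

theorem IsBM.norm_setIntegral_le [IsProbabilityMeasure P] (hB : IsBM P F B)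
    (hmono : Monotone F) (hle : ∀ s, F s ≤ mΩ)
    (hτ : StrictAnti τ) (hτ0 : ∀ n, 0 < τ n) (hU : ∀ n, Measurable[F (τ n)] (U n))
    (hU1 : ∀ n ω, ‖U n ω‖ ≤ 1) (n : ℕ) {A : Set Ω} (hA : MeasurableSet[futureFilt B (τ n)] A) :
    ‖∫ ω in A, U (n + 1) ω * charProd B τ (n + 1) ω ∂P‖ ≤
      Real.exp (-(2 * Real.pi ^ 2) / (τ n - τ (n + 1))) := by
  have hlt : τ (n + 1) < τ n := hτ n.lt_succ_self
  have hF : F (τ (n + 1)) ≤ F (τ n) := hmono hlt.le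
  have hinc : Measurable[futureFilt B (τ (n + 1))]
      fun ω => unitExp (incrementRatio B (τ (n + 1)) (τ n) ω) :=
    measurable_unitExp.comp ((measurable_sub_futureFilt hlt.le le_rfl).div_const _)
  have hincF : Measurable[F (τ n)] fun ω => unitExp (incrementRatio B (τ (n + 1)) (τ n) ω) :=
    measurable_unitExp.comp (((hB.2.2.1 _ (hτ0 n).le).sub
      ((hB.2.2.1 _ (hτ0 (n + 1)).le).mono hF le_rfl)).div_const _)
  set V : Ω → ℂ := A.indicator (charProd B τ n) with hV
  have hVm : Measurable[futureFilt B (τ n)] V := (measurable_charProd hτ.antitone n).indicator hA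
  have hV1 : ∀ ω, ‖V ω‖ ≤ 1 := fun ω =>
    (norm_indicator_le_norm_self _ ω).trans (norm_charProd τ n ω).le
  have hfut := fun k => hB.futureFilt_le hle (hτ0 k).le
  rw [← integral_indicator (hfut n _ hA)]
  have e₁ : (A.indicator fun ω => U (n + 1) ω * charProd B τ (n + 1) ω) =
      fun ω => V ω * (unitExp (incrementRatio B (τ (n + 1)) (τ n) ω) * U (n + 1) ω) := by
    funext ω
    by_cases h : ω ∈ A
    · simp only [hV, indicator_of_mem h, charProd, Finset.prod_range_succ]
      ring
    · simp [hV, h]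
  have hbound : ∀ f : Ω → ℂ, (∀ ω, ‖f ω‖ ≤ 1) → ‖∫ ω, f ω ∂P‖ ≤ 1 := fun f hf => by
    simpa using norm_integral_le_of_norm_le_const (μ := P) (.of_forall hf)
  have hprod : Measurable[F (τ n)] fun ω =>
      unitExp (incrementRatio B (τ (n + 1)) (τ n) ω) * U (n + 1) ω :=
    hincF.mul ((hU (n + 1)).mono hF le_rfl)
  rw [e₁, integral_mul_of_indep (hfut n) (hle _) (hB.indep_futureFilt hmono hle (hτ0 n).le) hVm
      hprod,
    integral_mul_of_indep (hfut (n + 1)) (hle _)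
      (hB.indep_futureFilt hmono hle (hτ0 (n + 1)).le) hinc (hU (n + 1)), norm_mul, norm_mul,
    hB.norm_integral_unitExp hle (hτ0 _).le hlt]
  have h₁ := hbound V hV1
  have h₂ := hbound _ (hU1 (n + 1))
  have h₃ := Real.exp_pos (-(2 * Real.pi ^ 2) / (τ n - τ (n + 1)))
  calc _ ≤ 1 * (Real.exp (-(2 * Real.pi ^ 2) / (τ n - τ (n + 1))) * 1) := by gcongr
    _ = _ := by ring

theorem tendsto_exp_neg_div_sub (hτ : StrictAnti τ) (hτl : Tendsto τ atTop (nhds 0)) :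
    Tendsto (fun n => Real.exp (-(2 * Real.pi ^ 2) / (τ n - τ (n + 1)))) atTop (nhds 0) := by
  have h₁ : Tendsto (fun n => τ n - τ (n + 1)) atTop (nhdsWithin 0 (Ioi 0)) := by
    refine tendsto_nhdsWithin_iff.2 ⟨?_, .of_forall fun n => sub_pos.2 (hτ n.lt_succ_self)⟩
    simpa using hτl.sub (hτl.comp (tendsto_add_atTop_nat 1))
  refine Real.tendsto_exp_atBot.comp ?_
  simp only [div_eq_mul_inv]
  exact h₁.inv_tendsto_nhdsGT_zero.const_mul_atTop_of_neg (by
    have := Real.pi_pos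
    have : 0 < Real.pi ^ 2 := by positivity
    linarith)

theorem IsBM.natFilt_le_iSup_futureFilt (hB : IsBM P F B)
    (hτl : Tendsto τ atTop (nhds 0)) (T : ℝ) : natFilt B T ≤ ⨆ n, futureFilt B (τ n) := by
  refine iSup₂_le fun r hr => Measurable.comap_le ?_
  rcases eq_or_lt_of_le hr.1 with rfl | hr0
  · rw [show B 0 = fun _ => 0 from funext hB.1]
    exact measurable_const
  obtain ⟨N, hN⟩ := eventually_atTop.1 (hτl.eventually_lt_const hr0)
  refine @measurable_of_tendsto_metrizable _ _ (⨆ n, futureFilt B (τ n)) _ _ _ _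
    (fun n ω => B r ω - B (τ (n + N)) ω) _ (fun n => ?_) ?_
  · exact (measurable_sub_futureFilt (hN _ (by omega)).le le_rfl).mono
      (le_iSup (fun n => futureFilt B (τ n)) (n + N)) le_rfl
  · rw [tendsto_pi_nhds]
    intro ω
    have h := ((hB.2.1 ω).tendsto 0).comp (hτl.comp (tendsto_add_atTop_nat N))
    simpa [hB.1 ω] using tendsto_const_nhds (x := B r ω) |>.sub h

theorem IsBM.tendsto_setIntegral [IsProbabilityMeasure P] (hB : IsBM P F B)
    (hmono : Monotone F) (hle : ∀ s, F s ≤ mΩ)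
    (hτ : StrictAnti τ) (hτ0 : ∀ n, 0 < τ n) (hτl : Tendsto τ atTop (nhds 0))
    (hU : ∀ n, Measurable[F (τ n)] (U n)) (hU1 : ∀ n ω, ‖U n ω‖ ≤ 1) {A : Set Ω}
    (hA : MeasurableSet[⨆ n, futureFilt B (τ n)] A) :
    Tendsto (fun n => ∫ ω in A, U (n + 1) ω * charProd B τ (n + 1) ω ∂P) atTop (nhds 0) := by
  have hfut := fun k => hB.futureFilt_le hle (hτ0 k).le
  have hsup : ⨆ n, futureFilt B (τ n) ≤ mΩ := iSup_le hfut
  have hWm : ∀ n, Measurable fun ω => U (n + 1) ω * charProd B τ (n + 1) ω := fun n =>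
    ((hU (n + 1)).mono (hle _) le_rfl).mul
      ((measurable_charProd hτ.antitone _).mono (hfut _) le_rfl)
  have hW1 : ∀ n ω, ‖U (n + 1) ω * charProd B τ (n + 1) ω‖ ≤ 1 := fun n ω => by
    rw [norm_mul, norm_charProd, mul_one]
    exact hU1 _ _
  have hWi : ∀ n, Integrable (fun ω => U (n + 1) ω * charProd B τ (n + 1) ω) P := fun n =>
    Integrable.of_bound (hWm n).aestronglyMeasurable 1 (.of_forall (hW1 n))
  have hbasic : ∀ A, (∃ k, MeasurableSet[futureFilt B (τ k)] A) →
      Tendsto (fun n => ∫ ω in A, U (n + 1) ω * charProd B τ (n + 1) ω ∂P) atTop (nhds 0) := by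
    rintro A ⟨k, hA⟩
    refine squeeze_zero_norm' ?_ (tendsto_exp_neg_div_sub hτ hτl)
    filter_upwards [eventually_ge_atTop k] with n hn
    exact hB.norm_setIntegral_le hmono hle hτ hτ0 hU hU1 n
      (futureFilt_antitone (hτ.antitone hn) _ hA)
  induction A, hA using MeasurableSpace.induction_on_inter
    (s := {A | ∃ k, MeasurableSet[futureFilt B (τ k)] A}) with
  | h_eq =>
    rw [← MeasurableSpace.generateFrom_iUnion_measurableSet]
    congr 1
    ext
    simp
  | h_inter =>
    rintro A ⟨k, hA⟩ A' ⟨l, hA'⟩ -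
    exact ⟨max k l, MeasurableSet.inter
      (futureFilt_antitone (hτ.antitone (le_max_left k l)) _ hA)
      (futureFilt_antitone (hτ.antitone (le_max_right k l)) _ hA')⟩
  | empty => simp
  | basic A hA => exact hbasic A hA
  | compl A hA ih =>
    have huniv := hbasic univ ⟨0, MeasurableSet.univ⟩
    simp only [Measure.restrict_univ] at huniv
    simp only [setIntegral_compl (hsup _ hA) (hWi _)]
    simpa using huniv.sub ih
  | iUnion f hd hf ih =>
    have hm : ∀ i, MeasurableSet (f i) := fun i => hsup _ (hf i)
    simp only [integral_iUnion hm hd (hWi _).integrableOn]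
    have hsum : Summable fun i => P.real (f i) := by
      have h : ∑' i, P (f i) ≠ ⊤ := by
        rw [← measure_iUnion hd hm]
        exact measure_ne_top _ _
      exact ENNReal.summable_toReal h
    have := tendsto_tsum_of_dominated_convergence (𝓕 := atTop)
      (f := fun n i => ∫ ω in f i, U (n + 1) ω * charProd B τ (n + 1) ω ∂P) (g := fun _ => 0)
      hsum ih (.of_forall fun n i => by
        simpa using norm_setIntegral_le_of_norm_le_const (μ := P) (s := f i)
          (measure_lt_top _ _) fun ω _ => hW1 n ω)
    simpa using this

theorem augFilt_le_eventuallyMeasurableSpace (T : ℝ) :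
    augFilt P B T ≤ eventuallyMeasurableSpace (natFilt B T) (ae P) := by
  refine sup_le le_eventuallyMeasurableSpace (MeasurableSpace.generateFrom_le fun s hs => ?_)
  exact ⟨∅, @MeasurableSet.empty _ (natFilt B T), ae_eq_empty.2 hs⟩

theorem IsBM.measure_tsirelson_recursion_eq_zero [IsProbabilityMeasure P] (hB : IsBM P F B)
    (hmono : Monotone F) (hle : ∀ s, F s ≤ mΩ) (hτ : StrictAnti τ) (hτ0 : ∀ n, 0 < τ n)
    (hτl : Tendsto τ atTop (nhds 0)) {Y : ℕ → Ω → ℝ} (hY : ∀ n, Measurable[F (τ n)] (Y n))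
    {T : ℝ} (hYaug : ∀ n, Measurable[augFilt P B T] (Y n))
    (hinc : ∀ n, Measurable[augFilt P B T] (B (τ n))) :
    P {ω | ∀ n, Y n ω = Int.fract (Y (n + 1) ω) + incrementRatio B (τ (n + 1)) (τ n) ω} = 0 := by
  set E := {ω | ∀ n, Y n ω = Int.fract (Y (n + 1) ω) + incrementRatio B (τ (n + 1)) (τ n) ω}
    with hE
  have hEm : ∀ m : MeasurableSpace Ω, (∀ n, Measurable[m] (Y n)) → (∀ n, Measurable[m] (B (τ n))) →
      MeasurableSet[m] E := fun m h₁ h₂ => by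
    rw [hE, ofPred_forall]
    refine MeasurableSet.iInter fun n => measurableSet_eq_fun (h₁ n) ?_
    exact (measurable_fract.comp (h₁ (n + 1))).add (((h₂ n).sub (h₂ (n + 1))).div_const _)
  have hB' : ∀ n, Measurable (B (τ n)) := fun n => hB.measurable hle (hτ0 n).le
  have hY' : ∀ n, Measurable (Y n) := fun n => (hY n).mono (hle _) le_rfl
  have hEΩ : MeasurableSet E := hEm _ hY' hB'
  have hrec : ∀ ω ∈ E, ∀ n, unitExp (Y 0 ω) = unitExp (Y n ω) * charProd B τ n ω := by
    intro ω hω n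
    induction n with
    | zero => simp [charProd]
    | succ n ih =>
      rw [ih, hω n, unitExp_add, unitExp_fract, charProd, charProd, Finset.prod_range_succ]
      ring
  have hzero : ∀ A, MeasurableSet[augFilt P B T] A → MeasurableSet A →
      ∫ ω in A, E.indicator (fun ω => unitExp (Y 0 ω)) ω ∂P = 0 := by
    intro A hA hAm
    obtain ⟨A', hA', hAA'⟩ := augFilt_le_eventuallyMeasurableSpace T (A ∩ E)
      (MeasurableSet.inter hA (hEm _ hYaug hinc))
    have hlim := hB.tendsto_setIntegral hmono hle hτ hτ0 hτl (U := fun n ω => unitExp (Y n ω))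
      (fun n => measurable_unitExp.comp (hY n)) (fun n ω => (norm_unitExp _).le)
      (hB.natFilt_le_iSup_futureFilt hτl T _ hA')
    rw [setIntegral_indicator hEΩ]
    refine tendsto_nhds_unique (tendsto_const_nhds.congr fun n => ?_) hlim
    rw [← setIntegral_congr_set hAA']
    exact setIntegral_congr_fun (hAm.inter hEΩ) fun ω hω => hrec ω hω.2 (n + 1)
  have hmm : ∀ {f : Ω → ℝ}, Measurable[augFilt P B T] f → Measurable[mΩ] f →
      Measurable[augFilt P B T ⊓ mΩ] f :=
    fun h₁ h₂ s hs => MeasurableSpace.measurableSet_inf.2 ⟨h₁ hs, h₂ hs⟩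
  have hfm : Measurable[augFilt P B T ⊓ mΩ] (E.indicator fun ω => unitExp (Y 0 ω)) :=
    (measurable_unitExp.comp (hmm (hYaug 0) (hY' 0))).indicator
      (MeasurableSpace.measurableSet_inf.2 ⟨hEm _ hYaug hinc, hEΩ⟩)
  have hmle : augFilt P B T ⊓ mΩ ≤ mΩ := inf_le_right
  have hae := ae_eq_zero_of_forall_setIntegral_eq_of_finStronglyMeasurable_trim (μ := P) hmle
    (f := E.indicator fun ω => unitExp (Y 0 ω))
    (fun s _ _ => ((Integrable.of_bound (μ := P) (hfm.mono hmle le_rfl).aestronglyMeasurable 1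
      (.of_forall fun ω => (norm_indicator_le_norm_self _ ω).trans
        (norm_unitExp _).le))).integrableOn)
    (fun s hs _ => hzero s (MeasurableSpace.measurableSet_inf.1 hs).1 (hmle s hs))
    (hfm.stronglyMeasurable.finStronglyMeasurable _)
  have : ∀ᵐ ω ∂P, ω ∉ E := by
    filter_upwards [hae] with ω hω hωE
    rw [indicator_of_mem hωE] at hω
    simpa [hω] using norm_unitExp (Y 0 ω)
  simpa [ae_iff] using this

end WeakLimit
section Measurability

variable {Ω : Type*}

theorem ProgMeas.measurable_setIntegral {F : ℝ → MeasurableSpace Ω} {u : ℝ → Ω → ℝ}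
    (hu : ProgMeas F u) {s : ℝ} (hs : 0 ≤ s) :
    Measurable[F s] fun ω => ∫ r in Icc (0 : ℝ) s, u r ω := by
  let m := F s
  have h : Measurable fun p : Icc (0 : ℝ) s × Ω => u p.1 p.2 := hu s hs
  have hfin : IsFiniteMeasure (Measure.comap ((↑) : Icc (0 : ℝ) s → ℝ) volume) :=
    ⟨by
      rw [comap_subtype_coe_apply measurableSet_Icc, image_univ, Subtype.range_coe]
      exact measure_Icc_lt_top⟩
  have h' := (h.stronglyMeasurable.integral_prod_left'
    (μ := Measure.comap ((↑) : Icc (0 : ℝ) s → ℝ) volume)).measurable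
  have heq : ∀ ω, ∫ r in Icc (0 : ℝ) s, u r ω =
      ∫ r : Icc (0 : ℝ) s, u r ω ∂Measure.comap Subtype.val volume := fun ω =>
    (integral_subtype_comap measurableSet_Icc fun r => u r ω).symm
  simpa only [heq] using h'

theorem ProgMeas.aemeasurable_path {F : ℝ → MeasurableSpace Ω} {u : ℝ → Ω → ℝ}
    (hu : ProgMeas F u) {s : ℝ} (hs : 0 ≤ s) (ω : Ω) :
    AEMeasurable (fun r => u r ω) (volume.restrict (Icc 0 s)) := by
  let m := F s
  have h : Measurable fun p : Icc (0 : ℝ) s × Ω => u p.1 p.2 := hu s hs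
  exact aemeasurable_restrict_of_measurable_subtype measurableSet_Icc
    (h.comp measurable_prodMk_right)

theorem measurable_natFilt (B : ℝ → Ω → ℝ) {r s : ℝ} (hr : r ∈ Icc 0 s) :
    Measurable[natFilt B s] (B r) :=
  (comap_measurable _).mono (le_iSup₂ (f := fun r (_ : r ∈ Icc (0 : ℝ) s) =>
    MeasurableSpace.comap (B r) inferInstance) r hr) le_rfl

theorem augFilt_mono [MeasurableSpace Ω] (P : Measure Ω) (B : ℝ → Ω → ℝ) :
    Monotone (augFilt P B) := fun _ _ h =>
  sup_le_sup_right (biSup_mono fun _ hr => ⟨hr.1, hr.2.trans h⟩) _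

end Measurability

section Paths

variable {T : ℝ} {a w x : ℝ → ℝ} {t : ℤ → ℝ}

theorem alphaStar_eq_of_hasDerivAt (ha : ∀ s, a s ∈ Icc (0 : ℝ) 1)
    (hx : ∀ s ∈ Icc (0 : ℝ) T, x s = (∫ r in Icc (0 : ℝ) s, a r) + w s) {s : ℝ}
    (hs : s ∈ Ioo 0 T) (hd : HasDerivAt (fun u => ∫ r in (0 : ℝ)..u, a r) (a s) s) :
    alphaStar s w x = a s := by
  have hsub : ∀ u ∈ Icc 0 T, x u - w u = ∫ r in (0 : ℝ)..u, a r := fun u hu => by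
    rw [hx u hu, add_sub_cancel_right, integral_Icc_eq_integral_Ioc,
      intervalIntegral.integral_of_le hu.1]
  have hlim : Tendsto
      (fun h : ℝ => ((x s - w s) - (x (max (s - h) 0) - w (max (s - h) 0))) / h)
      (nhdsWithin 0 (Ioi 0)) (nhds (a s)) := by
    have h₁ : Tendsto (fun h : ℝ => s - h) (nhdsWithin 0 (Ioi 0)) (nhdsWithin s {s}ᶜ) := by
      refine tendsto_nhdsWithin_iff.2 ⟨?_, ?_⟩
      · have : Tendsto (fun h : ℝ => s - h) (nhds 0) (nhds (s - 0)) :=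
          tendsto_const_nhds.sub tendsto_id
        rw [sub_zero] at this
        exact this.mono_left nhdsWithin_le_nhds
      · filter_upwards [self_mem_nhdsWithin] with h hh
        have : 0 < h := hh
        simp [this.ne']
    refine ((hasDerivAt_iff_tendsto_slope.1 hd).comp h₁).congr' ?_
    filter_upwards [Ioo_mem_nhdsGT hs.1] with h hh
    have hpos : 0 < s - h := sub_pos.2 hh.2
    rw [max_eq_left hpos.le, hsub s ⟨hs.1.le, hs.2.le⟩,
      hsub (s - h) ⟨hpos.le, by linarith [hs.2, hh.1]⟩, Function.comp_apply, slope_def_field]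
    have := hh.1.ne'
    rw [show s - h - s = -h by ring, div_neg, ← neg_div, neg_sub]
  rw [alphaStar, hlim.limsup_eq, min_eq_right (ha s).2, max_eq_right (ha s).1]

theorem TsirelsonTimes.strictAnti (ht : TsirelsonTimes T t) :
    StrictAnti fun n : ℕ => t (-(n : ℤ)) :=
  strictAnti_nat_of_succ_lt fun n => by
    have := ht.2.1 (-(n : ℤ)) (by omega)
    rwa [show -((n + 1 : ℕ) : ℤ) = -(n : ℤ) - 1 by push_cast; ring]

theorem TsirelsonTimes.pos (ht : TsirelsonTimes T t) (n : ℕ) : 0 < t (-(n : ℤ)) :=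
  (ht.strictAnti.antitone.le_of_tendsto ht.2.2 (n + 1)).trans_lt (ht.strictAnti n.lt_succ_self)

theorem TsirelsonTimes.drift_eq (ht : TsirelsonTimes T t) (n : ℕ) {s : ℝ}
    (hs : s ∈ Ico (t (-((n + 1 : ℕ) : ℤ))) (t (-(n : ℤ)))) :
    tsirelsonDrift t s x =
      Int.fract ((x (t (-((n + 1 : ℕ) : ℤ))) - x (t (-((n + 2 : ℕ) : ℤ)))) /
        (t (-((n + 1 : ℕ) : ℤ)) - t (-((n + 2 : ℕ) : ℤ)))) := by
  have h : ∃ k : ℤ, k ≤ -1 ∧ t k ≤ s ∧ s < t (k + 1) :=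
    ⟨-((n + 1 : ℕ) : ℤ), by omega, hs.1, by
      rw [show -((n + 1 : ℕ) : ℤ) + 1 = -(n : ℤ) by push_cast; ring]; exact hs.2⟩
  have hk : h.choose = -((n + 1 : ℕ) : ℤ) := by
    obtain ⟨h₁, h₂, h₃⟩ := h.choose_spec
    obtain ⟨m, hm⟩ : ∃ m : ℕ, h.choose = -((m + 1 : ℕ) : ℤ) :=
      ⟨(-h.choose - 1).toNat, by omega⟩
    rw [hm] at h₂ h₃ ⊢
    rw [show -((m + 1 : ℕ) : ℤ) + 1 = -(m : ℤ) by push_cast; ring] at h₃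
    have e₁ : m < n + 1 := ht.strictAnti.lt_iff_gt.1 (hs.1.trans_lt h₃)
    have e₂ : n < m + 1 := ht.strictAnti.lt_iff_gt.1 (h₂.trans_lt hs.2)
    rw [show m = n by omega]
  rw [tsirelsonDrift, dif_pos h, hk,
    show -((n + 1 : ℕ) : ℤ) - 1 = -((n + 2 : ℕ) : ℤ) by push_cast; ring]

theorem TsirelsonTimes.Ioo_subset_iUnion (ht : TsirelsonTimes T t) :
    Ioo 0 T ⊆ ⋃ n : ℕ, Ico (t (-((n + 1 : ℕ) : ℤ))) (t (-(n : ℤ))) := by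
  intro s hs
  have hex : ∃ n : ℕ, t (-(n : ℤ)) ≤ s :=
    (ht.2.2.eventually_le_const hs.1).exists
  have hne : Nat.find hex ≠ 0 := fun h0 => by
    have := Nat.find_spec hex
    rw [h0] at this
    have h1 := ht.1
    simp only [Nat.cast_zero, neg_zero] at this
    linarith [hs.2]
  obtain ⟨n, hn⟩ := Nat.exists_eq_succ_of_ne_zero hne
  refine mem_iUnion.2 ⟨n, ?_, ?_⟩
  · have := Nat.find_spec hex
    rwa [hn] at this
  · exact not_le.1 (Nat.find_min hex (by omega))

theorem TsirelsonTimes.aemeasurable_drift (ht : TsirelsonTimes T t) :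
    AEMeasurable (fun s => tsirelsonDrift t s x) (volume.restrict (Icc 0 T)) := by
  rw [← restrict_Ioo_eq_restrict_Icc]
  refine AEMeasurable.mono_set ht.Ioo_subset_iUnion ?_
  rw [aemeasurable_iUnion_iff]
  intro n
  refine AEMeasurable.congr (aemeasurable_const
    (b := Int.fract ((x (t (-((n + 1 : ℕ) : ℤ))) - x (t (-((n + 2 : ℕ) : ℤ)))) /
      (t (-((n + 1 : ℕ) : ℤ)) - t (-((n + 2 : ℕ) : ℤ)))))) ?_
  filter_upwards [ae_restrict_mem measurableSet_Ico] with s hs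
  exact (ht.drift_eq n hs).symm

theorem tsirelsonDrift_mem_Icc (s : ℝ) : tsirelsonDrift t s x ∈ Icc (0 : ℝ) 1 := by
  rw [tsirelsonDrift]
  split_ifs
  · exact ⟨Int.fract_nonneg _, (Int.fract_lt_one _).le⟩
  · simp

theorem TsirelsonTimes.ae_eq_drift (hT : 0 < T) (ht : TsirelsonTimes T t)
    (ha : ∀ s, a s ∈ Icc (0 : ℝ) 1) (ham : AEMeasurable a (volume.restrict (Icc 0 T)))
    (hx : ∀ s ∈ Icc (0 : ℝ) T, x s = (∫ r in Icc (0 : ℝ) s, a r) + w s)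
    (hD : (w, x) ∈ tsirelsonSetD T t) :
    ∀ᵐ s ∂volume.restrict (Icc 0 T), a s = tsirelsonDrift t s x := by
  have hai : IntervalIntegrable a volume 0 T := by
    rw [intervalIntegrable_iff_integrableOn_Icc_of_le hT.le]
    exact Integrable.of_bound ham.aestronglyMeasurable 1 (.of_forall fun s => by
      rw [Real.norm_eq_abs, abs_le]
      constructor <;> linarith [(ha s).1, (ha s).2])
  have hstar : ∀ᵐ s ∂volume.restrict (Icc 0 T), alphaStar s w x = a s := by
    rw [← restrict_Ioo_eq_restrict_Icc, ae_restrict_iff' measurableSet_Ioo]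
    filter_upwards [hai.ae_hasDerivAt_integral] with s hs hsT
    refine alphaStar_eq_of_hasDerivAt ha hx hsT (hs ?_ 0 left_mem_uIcc)
    rw [uIcc_of_le hT.le]
    exact Ioo_subset_Icc_self hsT
  have hintegral : ∫ s in Icc (0 : ℝ) T, |a s - tsirelsonDrift t s x| = 0 := by
    refine Eq.trans (integral_congr_ae ?_)
      (hD : ∫ s in Icc (0 : ℝ) T, |alphaStar s w x - tsirelsonDrift t s x| = 0)
    filter_upwards [hstar] with s hs
    simp only [hs]
  rw [integral_eq_zero_iff_of_nonneg (fun s => abs_nonneg _)] at hintegral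
  · filter_upwards [hintegral] with s hs
    exact sub_eq_zero.1 (abs_eq_zero.1 hs)
  · refine Integrable.of_bound (ham.sub ht.aemeasurable_drift).abs.aestronglyMeasurable 1
      (.of_forall fun s => ?_)
    have := tsirelsonDrift_mem_Icc (t := t) (x := x) s
    rw [Real.norm_eq_abs, abs_abs, abs_le]
    constructor <;> linarith [(ha s).1, (ha s).2, this.1, this.2]

theorem TsirelsonTimes.recursion_of_mem_setD (hT : 0 < T) (ht : TsirelsonTimes T t)
    (ha : ∀ s, a s ∈ Icc (0 : ℝ) 1) (ham : AEMeasurable a (volume.restrict (Icc 0 T)))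
    (hx : ∀ s ∈ Icc (0 : ℝ) T, x s = (∫ r in Icc (0 : ℝ) s, a r) + w s)
    (hD : (w, x) ∈ tsirelsonSetD T t) (n : ℕ) :
    (x (t (-(n : ℤ))) - x (t (-((n + 1 : ℕ) : ℤ)))) /
        (t (-(n : ℤ)) - t (-((n + 1 : ℕ) : ℤ))) =
      Int.fract ((x (t (-((n + 1 : ℕ) : ℤ))) - x (t (-((n + 2 : ℕ) : ℤ)))) /
        (t (-((n + 1 : ℕ) : ℤ)) - t (-((n + 2 : ℕ) : ℤ)))) +
      (w (t (-(n : ℤ))) - w (t (-((n + 1 : ℕ) : ℤ)))) /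
        (t (-(n : ℤ)) - t (-((n + 1 : ℕ) : ℤ))) := by
  have hae := ht.ae_eq_drift hT ha ham hx hD
  have hdrift : ∀ s ∈ Ico (t (-((n + 1 : ℕ) : ℤ))) (t (-(n : ℤ))), tsirelsonDrift t s x = _ :=
    fun s hs => ht.drift_eq n hs
  set c := Int.fract ((x (t (-((n + 1 : ℕ) : ℤ))) - x (t (-((n + 2 : ℕ) : ℤ)))) /
        (t (-((n + 1 : ℕ) : ℤ)) - t (-((n + 2 : ℕ) : ℤ)))) with hc
  have hu_le : t (-(n : ℤ)) ≤ T := by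
    have := ht.strictAnti.antitone n.zero_le
    simpa [ht.1] using this
  have hs0 := ht.pos (n + 1)
  have hsu : t (-((n + 1 : ℕ) : ℤ)) < t (-(n : ℤ)) := ht.strictAnti n.lt_succ_self
  set s := t (-((n + 1 : ℕ) : ℤ))
  set u := t (-(n : ℤ))
  have hai : IntegrableOn a (Icc 0 T) :=
    Integrable.of_bound ham.aestronglyMeasurable 1 (.of_forall fun s => by
      rw [Real.norm_eq_abs, abs_le]
      constructor <;> linarith [(ha s).1, (ha s).2])
  have hII : ∀ v ∈ Icc 0 T, IntervalIntegrable a volume 0 v := fun v hv => by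
    rw [intervalIntegrable_iff_integrableOn_Icc_of_le hv.1]
    exact hai.mono_set (Icc_subset_Icc_right hv.2)
  have hIcc : ∀ v ∈ Icc 0 T, x v = (∫ r in (0 : ℝ)..v, a r) + w v := fun v hv => by
    rw [hx v hv, integral_Icc_eq_integral_Ioc, intervalIntegral.integral_of_le hv.1]
  have hsT : s ∈ Icc 0 T := ⟨hs0.le, hsu.le.trans hu_le⟩
  have huT : u ∈ Icc 0 T := ⟨(hs0.trans hsu).le, hu_le⟩
  have hconst : ∫ r in s..u, a r = (u - s) * c := by
    rw [intervalIntegral.integral_of_le hsu.le, ← integral_Ico_eq_integral_Ioc,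
      setIntegral_congr_ae (g := fun _ => c) measurableSet_Ico]
    · simp [hsu.le]
    · rw [ae_restrict_iff' measurableSet_Icc] at hae
      filter_upwards [hae] with r hr hrs
      rw [hr ⟨hs0.le.trans hrs.1, hrs.2.le.trans hu_le⟩, hdrift r hrs]
  have hdiff := intervalIntegral.integral_interval_sub_left (hII u huT) (hII s hsT)
  have hpos : u - s ≠ 0 := (sub_pos.2 hsu).ne'
  rw [hIcc u huT, hIcc s hsT]
  field_simp
  linarith

end Paths

theorem ControlWeakSol.measure_setD_eq_zero {T : ℝ} (hT : 0 < T) {t : ℤ → ℝ}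
    (ht : TsirelsonTimes T t) (S : ControlWeakSol T) (hS : S.OpenLoop) :
    S.P {ω | ((fun s => S.B s ω), (fun s => S.X s ω)) ∈ tsirelsonSetD T t} = 0 := by
  have := S.hP
  set τ : ℕ → ℝ := fun n => t (-(n : ℤ)) with hτ
  have hmono : Monotone S.F := fun s u h => S.F_mono s u h
  have hτT : ∀ n, τ n ≤ T := fun n => by
    have := ht.strictAnti.antitone n.zero_le
    simpa [ht.1] using this
  set Z : ℝ → S.Ω → ℝ := fun s ω => (∫ r in Icc (0 : ℝ) s, S.α r ω) + S.B s ω with hZ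
  have hBaug : ∀ n, Measurable[augFilt S.P S.B T] (S.B (τ n)) := fun n =>
    (measurable_natFilt S.B ⟨(ht.pos n).le, hτT n⟩).mono le_sup_left le_rfl
  have hZaug : ∀ n, Measurable[augFilt S.P S.B T] (Z (τ n)) := fun n =>
    ((hS.measurable_setIntegral (ht.pos n).le).mono
      (augFilt_mono S.P S.B (hτT n)) le_rfl).add (hBaug n)
  have hZF : ∀ n, Measurable[S.F (τ n)] (Z (τ n)) := fun n =>
    (S.α_prog.measurable_setIntegral (ht.pos n).le).add (S.hB.2.2.1 _ (ht.pos n).le)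
  have key := S.hB.measure_tsirelson_recursion_eq_zero hmono S.F_le ht.strictAnti ht.pos ht.2.2
    (Y := fun n => incrementRatio Z (τ (n + 1)) (τ n)) (T := T)
    (fun n => ((hZF n).sub ((hZF (n + 1)).mono
      (hmono (ht.strictAnti n.lt_succ_self).le) le_rfl)).div_const _)
    (fun n => ((hZaug n).sub (hZaug (n + 1))).div_const _) hBaug
  refine measure_mono_null_ae ?_ key
  filter_upwards [S.sde] with ω hω hD n
  have hZX : ∀ n, Z (τ n) ω = S.X (τ n) ω := fun n =>
    (hω _ ⟨(ht.pos n).le, hτT n⟩).symm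
  have := ht.recursion_of_mem_setD hT (fun s => S.α_mem s ω)
    (S.α_prog.aemeasurable_path hT.le ω) hω hD n
  simp only [incrementRatio, hZX]
  exact this

/-- For every weak solution with an open-loop control,
`P((B, X) ∈ D) = 0`; consequently the open-loop value satisfies `V^o_0 = 0`. -/
theorem open_loop_value_eq_zero
    (T : ℝ) (hT : 0 < T) (t : ℤ → ℝ) (ht : TsirelsonTimes T t) :
    (∀ S : ControlWeakSol T, S.OpenLoop →
      S.P {ω | ((fun s => S.B s ω), (fun s => S.X s ω)) ∈ tsirelsonSetD T t} = 0) ∧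
    VopenD T t = 0 := by
  refine ⟨fun S hS => S.measure_setD_eq_zero hT ht hS, ?_⟩
  refine le_antisymm (Real.sSup_nonpos ?_) (Real.sSup_nonneg ?_)
  all_goals
    rintro _ ⟨S, hS, rfl⟩
    simp [ControlWeakSol.payoff, S.measure_setD_eq_zero hT ht hS]

end
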